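/- arXiv:2103.13880 — 3 statements merged into one kernel-verified Lean document; each statement's English description precedes it below -/
import Mathlib

section
/- Let F be a field of characteristic p, let f(x) = ∏_{i=1}^t (x − α_i)^{e_i} ∈ F[x] have distinct nonzero zeros α_1, …, α_t in an extension E of F, and let s : ℤ → F be a nonzero f-sequence whose least period is m, where gcd(m, p) = 1 if p > 0. Let J = {i ∈ {1, …, t} | α_i^m = 1}. Then m = lcm{ord(α_i) | i ∈ J} = lcm{ord(α) | α a zero of f_s}, where ord denotes multiplicative order and f_s is the minimal recursion of s. -/
open Polynomial
open scoped Classical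

/-- `lrsApply f s` is the sequence `f(σ)s`, where `σ` is the left-shift operator:
`(f(σ)s)_n = ∑_i (coeff of x^i in f) * s_{n+i}`. -/
noncomputable def lrsApply {F : Type*} [CommRing F] (f : Polynomial F) (s : ℤ → F) : ℤ → F :=
  fun n => ∑ i ∈ Finset.range (f.natDegree + 1), f.coeff i * s (n + i)

theorem lrsApply_X_pow_sub_one_eq_zero_iff {F : Type*} [CommRing F] [Nontrivial F] (k : ℕ)
    (s : ℤ → F) :
    lrsApply (X ^ k - 1) s = 0 ↔ ∀ n : ℤ, s (n + k) = s n := by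
  have hdeg : (X ^ k - 1 : F[X]).natDegree = k := by
    simpa using natDegree_X_pow_sub_C (R := F) (n := k) (r := 1)
  simp [funext_iff, lrsApply, hdeg, coeff_X_pow, coeff_one, sub_mul, sub_eq_zero]

theorem natCast_ne_zero_of_coprime_ringChar {F : Type*} [Ring F] [Nontrivial F] {m : ℕ}
    (hm : 0 < m) (hchar : ringChar F = 0 ∨ Nat.Coprime m (ringChar F)) : (m : F) ≠ 0 := by
  intro h
  have hdvd := ringChar.dvd h
  rcases hchar with h0 | hco
  · rw [h0, zero_dvd_iff] at hdvd
    exact hm.ne' hdvd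
  · exact CharP.ringChar_ne_one (Nat.eq_one_of_dvd_coprimes hco hdvd dvd_rfl)

/-- Let `f = ∏ (x - α_i)^{e_i} ∈ F[x]` with distinct nonzero zeros `α_i` in an extension `E`,
and let `s` be a nonzero `f`-sequence over `F` with least period `m`, where
`gcd(m, char F) = 1` if `char F > 0`. With `J = {i | α_i^m = 1}`, we have
`m = lcm{ord(α_i) | i ∈ J} = lcm{ord(α) | α a zero of f_s}`, where `ord` is the
multiplicative order and `f_s` is the minimal recursion of `s`. -/
theorem least_period_eq_lcm_of_orders {F E : Type*} [Field F] [Field E] [Algebra F E]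
    (f : Polynomial F) (t : ℕ) (α : Fin t → E) (e : Fin t → ℕ)
    (hαinj : Function.Injective α) (hα0 : ∀ i, α i ≠ 0) (he : ∀ i, 1 ≤ e i)
    (hfact : f.map (algebraMap F E) = ∏ i, (X - C (α i)) ^ e i)
    (m : ℕ) (hm : 0 < m) (hchar : ringChar F = 0 ∨ Nat.Coprime m (ringChar F))
    (s : ℤ → F) (hs0 : s ≠ 0) (hseq : lrsApply f s = 0)
    (hper : ∀ n : ℤ, s (n + m) = s n)
    (hleast : ∀ m' : ℕ, 0 < m' → (∀ n : ℤ, s (n + m') = s n) → m ≤ m')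
    (fs : Polynomial F) (hmonic : fs.Monic)
    (hmin : ∀ g : Polynomial F, lrsApply g s = 0 ↔ fs ∣ g) :
    m = (Finset.univ.filter (fun i => α i ^ m = 1)).lcm (fun i => orderOf (α i)) ∧
    m = ((fs.map (algebraMap F E)).roots.toFinset).lcm orderOf := by
  have hmE : (m : E) ≠ 0 := by
    simpa using (map_ne_zero (algebraMap F E)).2 (natCast_ne_zero_of_coprime_ringChar hm hchar)
  have hfsm : fs.map (algebraMap F E) ∣ X ^ m - 1 := by
    simpa using Polynomial.map_dvd (algebraMap F E)
      ((hmin _).1 ((lrsApply_X_pow_sub_one_eq_zero_iff m s).2 hper))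
  have hfsf : fs.map (algebraMap F E) ∣ ∏ i, (X - C (α i)) ^ e i :=
    hfact ▸ Polynomial.map_dvd (algebraMap F E) ((hmin f).1 hseq)
  have hg0 : fs.map (algebraMap F E) ≠ 0 := (hmonic.map _).ne_zero
  have hsplits : (fs.map (algebraMap F E)).Splits :=
    Splits.of_dvd (Splits.prod fun i _ => (Splits.X_sub_C (α i)).pow (e i))
      (Finset.prod_ne_zero_iff.2 fun i _ => pow_ne_zero _ (X_sub_C_ne_zero _)) hfsf
  have hsep : (fs.map (algebraMap F E)).Separable :=
    ((X_pow_sub_one_separable_iff).2 hmE).of_dvd hfsm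
  have hroot_pow : ∀ a ∈ (fs.map (algebraMap F E)).roots, a ^ m = 1 := fun a ha => by
    simpa [sub_eq_zero] using (isRoot_of_mem_roots ha).dvd hfsm
  have hroot_mem : ∀ a ∈ (fs.map (algebraMap F E)).roots, ∃ i, α i = a := fun a ha => by
    have h := (isRoot_of_mem_roots ha).dvd hfsf
    simp only [IsRoot.def, eval_prod, eval_pow, eval_sub, eval_X, eval_C,
      Finset.prod_eq_zero_iff] at h
    obtain ⟨i, -, hi⟩ := h
    exact ⟨i, (sub_eq_zero.1 (eq_zero_of_pow_eq_zero hi)).symm⟩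
  have hlcm_dvd : (fs.map (algebraMap F E)).roots.toFinset.lcm orderOf ∣ m :=
    Finset.lcm_dvd fun a ha => orderOf_dvd_of_pow_eq_one (hroot_pow a (Multiset.mem_toFinset.1 ha))
  have hlcm_pos := Nat.pos_of_dvd_of_pos hlcm_dvd hm
  have hlcm : m = (fs.map (algebraMap F E)).roots.toFinset.lcm orderOf := by
    refine le_antisymm (hleast _ hlcm_pos ?_) (Nat.le_of_dvd hm hlcm_dvd)
    rw [← lrsApply_X_pow_sub_one_eq_zero_iff, hmin,
      ← Polynomial.map_dvd_map' (algebraMap F E)]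
    have hne : (X ^ ((fs.map (algebraMap F E)).roots.toFinset.lcm orderOf) - 1 : E[X]) ≠ 0 := by
      simpa using X_pow_sub_C_ne_zero hlcm_pos (1 : E)
    simp only [Polynomial.map_sub, Polynomial.map_pow, map_X, Polynomial.map_one]
    rw [hsplits.dvd_iff_roots_le_roots hg0 hne, Multiset.le_iff_subset (nodup_roots hsep)]
    intro a ha
    rw [mem_roots hne]
    simpa [sub_eq_zero] using
      orderOf_dvd_iff_pow_eq_one.1 (Finset.dvd_lcm (f := orderOf) (Multiset.mem_toFinset.2 ha))
  refine ⟨Nat.dvd_antisymm ?_ ?_, hlcm⟩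
  · conv_lhs => rw [hlcm]
    refine Finset.lcm_dvd fun a ha => ?_
    rw [Multiset.mem_toFinset] at ha
    obtain ⟨i, rfl⟩ := hroot_mem a ha
    exact Finset.dvd_lcm (f := fun i => orderOf (α i)) (by simpa using hroot_pow _ ha)
  · exact Finset.lcm_dvd fun i hi => orderOf_dvd_of_pow_eq_one (Finset.mem_filter.1 hi).2
end

section
/- Let a ∈ F_q^*, where q = p^e with p prime, let k ≥ 1, and let f(x) = (x − a)^k ∈ F_q[x]. If M is an f-subgroup in the multiplicative group of an extension field E of F_q, presented by an f-sequence s, then M = ⟨a⟩ and s is cyclic with s_{n+1} = a·s_n for all n ∈ ℤ; in particular M is a standard f-subgroup. -/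
open Polynomial

/-- The left shift of two-sided sequences, as a linear map. -/
noncomputable def leftShift (K : Type*) [Field K] : Module.End K (ℤ → K) :=
  LinearMap.funLeft K K fun n : ℤ => n + 1

theorem leftShift_pow_apply {K : Type*} [Field K] (i : ℕ) (s : ℤ → K) (n : ℤ) :
    (leftShift K ^ i) s n = s (n + i) := by
  induction i generalizing n with
  | zero => simp
  | succ i ih =>
    rw [pow_succ', Module.End.mul_apply]
    simp only [leftShift, LinearMap.funLeft_apply] at ih ⊢
    rw [ih]
    push_cast
    congr 1
    ring

theorem lrsApply_eq_aeval {K : Type*} [Field K] (f : Polynomial K) (s : ℤ → K) :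
    lrsApply f s = aeval (leftShift K) f s := by
  funext n
  simp [lrsApply, aeval_eq_sum_range, leftShift_pow_apply]

/-- A finite subgroup of the units of a field of characteristic `p` has order prime to `p`. -/
theorem coprime_natCard_units_subgroup {E : Type*} [Field E] (p : ℕ) [Fact p.Prime] [CharP E p]
    (M : Subgroup Eˣ) [Finite M] : p.Coprime (Nat.card M) := by
  rw [(Fact.out : p.Prime).coprime_iff_not_dvd]
  intro hdvd
  obtain ⟨x, hx⟩ := exists_prime_orderOf_dvd_card' p hdvd
  have hpow : ((x : Eˣ) : E) ^ p = 1 := by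
    have hxp : x ^ p = 1 := hx ▸ pow_orderOf_eq_one x
    simpa using congrArg (fun y : M => ((y : Eˣ) : E)) hxp
  have hone : ((x : Eˣ) : E) = 1 := by
    rw [← sub_eq_zero]
    apply eq_zero_of_pow_eq_zero (n := p)
    rw [sub_pow_char, hpow, one_pow, sub_self]
  have : x = 1 := Subtype.ext (Units.ext hone)
  rw [this, orderOf_one] at hx
  exact (Fact.out : p.Prime).one_lt.ne hx

/-- A sequence killed by a power of `σ - b` in characteristic `p` satisfies
`s (n + p ^ t) = b ^ p ^ t * s n` once `p ^ t` is at least the exponent. -/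
theorem apply_add_char_pow_of_lrsApply_eq_zero {K : Type*} [Field K] (p : ℕ) [Fact p.Prime]
    [CharP K p] {b : K} {k t : ℕ} (hkt : k ≤ p ^ t) {s : ℤ → K}
    (hs : lrsApply ((X - C b) ^ k) s = 0) (n : ℤ) :
    s (n + (p ^ t : ℕ)) = b ^ p ^ t * s n := by
  have hkill : aeval (leftShift K) ((X - C b) ^ p ^ t) s = 0 := by
    rw [← Nat.sub_add_cancel hkt, pow_add, map_mul, Module.End.mul_apply,
      ← lrsApply_eq_aeval ((X - C b) ^ k), hs, map_zero]
  rw [sub_pow_char_pow, ← C_pow] at hkill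
  have hn := congrFun hkill n
  simp only [map_sub, aeval_X_pow, aeval_C, LinearMap.sub_apply, Pi.sub_apply,
    leftShift_pow_apply, Module.algebraMap_end_apply, Pi.zero_apply,
    Pi.smul_apply, smul_eq_mul] at hn
  exact sub_eq_zero.mp hn

/-- An element of the finite field of order `p ^ e` is fixed by `x ↦ x ^ p ^ t` for some `p ^ t`
that is arbitrarily large and congruent to `1` modulo a number prime to `p`. -/
theorem exists_large_char_pow_fixing {F : Type*} [Field F] [Fintype F] {p e m : ℕ}
    (hp : p.Prime) (he : 0 < e) (hcard : Fintype.card F = p ^ e) (hm : 0 < m)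
    (hpm : p.Coprime m) (k : ℕ) :
    ∃ t, k ≤ p ^ t ∧ p ^ t ≡ 1 [MOD m] ∧ ∀ a : F, a ^ p ^ t = a := by
  refine ⟨e * (m.totient * k), ?_, ?_, fun a => ?_⟩
  · have hle : k ≤ e * (m.totient * k) := by
      rw [← mul_assoc]
      exact Nat.le_mul_of_pos_left k (Nat.mul_pos he (Nat.totient_pos.mpr hm))
    exact hle.trans (Nat.lt_pow_self hp.one_lt).le
  · rw [mul_left_comm, pow_mul]
    simpa using (Nat.ModEq.pow_totient hpm).pow (e * k)
  · rw [pow_mul, ← hcard, FiniteField.pow_card_pow]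

/-- Let `a ∈ F_q^*` where `q = p^e`, `p` prime, and let `f = (x - a)^k` with `k ≥ 1`.
If `M` is an `f`-subgroup of order `m` in the multiplicative group of an extension `E`
of `F_q`, presented by an `f`-sequence `s`, then `s` is cyclic with ratio `a` and
`M = ⟨a⟩`; in particular `M` is a standard `f`-subgroup. -/
theorem power_of_linear_fSubgroup_standard {F E : Type*} [Field F] [Fintype F]
    [Field E] [Algebra F E]
    (p e : ℕ) (hp : p.Prime) (he : 0 < e) (hcardF : Fintype.card F = p ^ e)
    (a : F) (ha : a ≠ 0) (k : ℕ) (hk : 1 ≤ k)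
    (f : Polynomial F) (hf : f = (X - C a) ^ k)
    (M : Subgroup Eˣ) (m : ℕ) (hm : 0 < m) (hcard : Nat.card M = m)
    (s : ℤ → E)
    (hseq : lrsApply (f.map (algebraMap F E)) s = 0)
    (hper : ∀ n : ℤ, s (n + m) = s n)
    (hinj : Function.Injective fun i : Fin m => s ((i : ℕ) : ℤ))
    (hrange : (Set.range fun i : Fin m => s ((i : ℕ) : ℤ)) = ((↑) : Eˣ → E) '' M) :
    (∀ n : ℤ, s (n + 1) = algebraMap F E a * s n) ∧
    ∀ ua : Eˣ, (ua : E) = algebraMap F E a → M = Subgroup.closure {ua} := by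
  have : Fact p.Prime := ⟨hp⟩
  have : CharP F p := charP_of_card_eq_prime_pow hcardF
  have : CharP E p := charP_of_injective_algebraMap (algebraMap F E).injective p
  have : Finite M := Nat.finite_of_card_ne_zero (by omega)
  obtain ⟨t, hkt, htm, hta⟩ := exists_large_char_pow_fixing hp he hcardF hm
    (hcard ▸ coprime_natCard_units_subgroup p M) k
  have hadd : ∀ n c : ℤ, s (n + c * m) = s n := fun n c =>
    (Function.Periodic.int_mul hper c) n
  have hmod : ∀ n : ℤ, s n ∈ Set.range fun i : Fin m => s ((i : ℕ) : ℤ) := by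
    intro n
    have hm' : (m : ℤ) ≠ 0 := by omega
    have h0 := Int.emod_nonneg n hm'
    have h1 := Int.emod_lt_of_pos n (by omega : (0 : ℤ) < m)
    refine ⟨⟨(n % m).toNat, by omega⟩, ?_⟩
    simp only [Int.toNat_of_nonneg h0]
    rw [← hadd _ (n / m), mul_comm, Int.emod_add_mul_ediv]
  have hcyc : ∀ n : ℤ, s (n + 1) = algebraMap F E a * s n := by
    intro n
    rw [hf, Polynomial.map_pow, Polynomial.map_sub, map_X, map_C] at hseq
    obtain ⟨c, hc⟩ := (Nat.modEq_iff_dvd.mp htm.symm)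
    have hsucc : n + (p ^ t : ℕ) = n + 1 + c * m := by
      push_cast at hc ⊢
      linarith
    have h := apply_add_char_pow_of_lrsApply_eq_zero p hkt hseq n
    rwa [hsucc, hadd, ← map_pow, hta] at h
  refine ⟨hcyc, fun ua hua => ?_⟩
  have hzpow : ∀ n c : ℤ, s (n + c) = ((ua ^ c : Eˣ) : E) * s n := by
    intro n c
    induction c using Int.induction_on with
    | zero => simp
    | succ i ih => rw [← add_assoc, hcyc, ih, ← hua, zpow_add_one, Units.val_mul]; ring
    | pred i ih =>
      apply ua.ne_zero |> mul_left_cancel₀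
      rw [hua, ← hcyc, ← hua, ← mul_assoc, ← Units.val_mul, ← zpow_one_add,
        ← add_sub_assoc, sub_add_cancel, add_sub_cancel, ih]
  obtain ⟨i, hi⟩ : (1 : E) ∈ Set.range fun i : Fin m => s ((i : ℕ) : ℤ) :=
    hrange ▸ ⟨1, M.one_mem, Units.val_one⟩
  simp only at hi
  apply le_antisymm
  · intro x hx
    obtain ⟨j, hj⟩ : (x : E) ∈ Set.range fun i : Fin m => s ((i : ℕ) : ℤ) :=
      hrange ▸ ⟨x, hx, rfl⟩
    simp only at hj
    rw [Subgroup.mem_closure_singleton]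
    refine ⟨(j : ℕ) - (i : ℕ), Units.ext ?_⟩
    have hij := hzpow (i : ℕ) ((j : ℕ) - (i : ℕ))
    rwa [add_sub_cancel, hj, hi, mul_one, eq_comm] at hij
  · rw [Subgroup.closure_le, Set.singleton_subset_iff]
    obtain ⟨y, hy, hys⟩ := hrange ▸ hmod ((i : ℕ) + 1)
    rw [hcyc, hi, mul_one, ← hua] at hys
    exact Units.ext hys ▸ hy
end

section
/- Let E be a field of characteristic p and let m > 1 with gcd(m, p) = 1 if p > 0. Suppose s_0, …, s_{m−1} ∈ E are such that M = {s_0, …, s_{m−1}} is a multiplicative subgroup of E^* of order m and the m-th cyclotomic polynomial Φ_m over E divides s̃(x) = s_0 x^{m−1} + s_1 x^{m−2} + ⋯ + s_{m−1}. Let f(x) = (x^m − 1)/gcd(x^m − 1, s̃(x)). Then f divides (x^m − 1)/((x − 1)·Φ_m(x)), and the period-m sequence s extending s_0, …, s_{m−1} is an f-sequence presenting M with minimal recursion f; hence M is an automatically non-standard f-subgroup. -/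
open Polynomial

section Periodic

variable {F : Type*} [CommRing F]

/-- The reciprocal generating polynomial `s_n x^{m-1} + s_{n+1} x^{m-2} + ⋯ + s_{n+m-1}` of the
window of length `m` of `s` starting at `n`. -/
noncomputable def windowPoly (m : ℕ) (s : ℤ → F) (n : ℤ) : F[X] :=
  ∑ i ∈ Finset.range m, C (s (n + i)) * X ^ (m - 1 - i)

theorem lrsApply_add_period {m : ℕ} {s : ℤ → F} (hper : ∀ n : ℤ, s (n + m) = s n) (g : F[X])
    (n : ℤ) : lrsApply g s (n + m) = lrsApply g s n := by
  refine Finset.sum_congr rfl fun i _ => ?_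
  rw [add_right_comm, hper]

theorem coeff_windowPoly {m : ℕ} (s : ℤ → F) (n : ℤ) {j : ℕ} (hj : j < m) :
    (windowPoly m s n).coeff (m - 1 - j) = s (n + j) := by
  simp only [windowPoly, finsetSum_coeff, coeff_C_mul, coeff_X_pow]
  rw [Finset.sum_eq_single_of_mem j (Finset.mem_range.2 hj)]
  · simp
  · intro i hi hij
    rw [Finset.mem_range] at hi
    rw [if_neg (by omega), mul_zero]

theorem degree_windowPoly_lt (m : ℕ) (s : ℤ → F) (n : ℤ) : (windowPoly m s n).degree < m := by
  refine (degree_sum_le _ _).trans_lt ((Finset.sup_lt_iff (WithBot.bot_lt_coe m)).2 fun i hi => ?_)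
  rw [Finset.mem_range] at hi
  exact (degree_C_mul_X_pow_le _ _).trans_lt (Nat.cast_lt.2 (by omega : m - 1 - i < m))

theorem windowPoly_eq_zero_iff {m : ℕ} (hm : 0 < m) {s : ℤ → F}
    (hper : ∀ n : ℤ, s (n + m) = s n) : windowPoly m s 0 = 0 ↔ s = 0 := by
  refine ⟨fun h => ?_, fun h => by simp [windowPoly, h]⟩
  have hp : Function.Periodic s (m : ℤ) := hper
  funext n
  have hm' : (m : ℤ) ≠ 0 := by exact_mod_cast hm.ne'
  have h0 := Int.emod_nonneg n hm'
  have h1 := Int.emod_lt_of_pos n (by exact_mod_cast hm : (0 : ℤ) < m)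
  obtain ⟨j, hj⟩ := Int.eq_ofNat_of_zero_le h0
  have hc := coeff_windowPoly s 0 (j := j) (m := m) (by omega)
  have hn : n = j + (n / m) * m := by
    rw [← hj]
    exact (Int.emod_add_ediv_mul n m).symm
  have hs : s (j + n / m * m) = s j := hp.int_mul (n / m) (j : ℤ)
  rw [hn, hs]
  simpa [h] using hc.symm

theorem X_mul_windowPoly {m : ℕ} (hm : 0 < m) {s : ℤ → F} (hper : ∀ n : ℤ, s (n + m) = s n)
    (n : ℤ) : X * windowPoly m s n = windowPoly m s (n + 1) + C (s n) * (X ^ m - 1) := by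
  obtain ⟨k, rfl⟩ : ∃ k, m = k + 1 := ⟨m - 1, by omega⟩
  have h : s (n + 1 + k) = s n := by
    rw [← hper n]
    push_cast
    ring_nf
  rw [windowPoly, windowPoly, Finset.sum_range_succ', Finset.sum_range_succ, mul_add,
    Finset.mul_sum, h]
  have : ∀ i ∈ Finset.range k,
      X * (C (s (n + (i + 1 : ℕ))) * X ^ (k + 1 - 1 - (i + 1)))
        = C (s (n + 1 + i)) * (X : F[X]) ^ (k + 1 - 1 - i) := by
    intro i hi
    rw [Finset.mem_range] at hi
    rw [show k + 1 - 1 - i = k + 1 - 1 - (i + 1) + 1 by omega, pow_succ]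
    push_cast
    rw [show n + ((i : ℤ) + 1) = n + 1 + i by ring]
    ring
  rw [Finset.sum_congr rfl this]
  simp
  ring

theorem X_pow_sub_one_dvd_X_pow_mul_windowPoly_sub {m : ℕ} (hm : 0 < m) {s : ℤ → F}
    (hper : ∀ n : ℤ, s (n + m) = s n) (k : ℕ) :
    X ^ m - 1 ∣ X ^ k * windowPoly m s 0 - windowPoly m s k := by
  induction k with
  | zero => simp
  | succ k ih =>
    have h := X_mul_windowPoly hm hper k
    have e : X ^ (k + 1) * windowPoly m s 0 - windowPoly m s (k + 1 : ℕ)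
        = X * (X ^ k * windowPoly m s 0 - windowPoly m s k) + C (s k) * (X ^ m - 1) := by
      push_cast
      linear_combination h
    rw [e]
    exact dvd_add (ih.mul_left _) (dvd_mul_left _ _)

theorem windowPoly_lrsApply (m : ℕ) (s : ℤ → F) (g : F[X]) :
    windowPoly m (lrsApply g s) 0
      = ∑ k ∈ Finset.range (g.natDegree + 1), C (g.coeff k) * windowPoly m s k := by
  simp only [windowPoly, lrsApply, map_sum, Finset.sum_mul, Finset.mul_sum]
  rw [Finset.sum_comm]
  refine Finset.sum_congr rfl fun k _ => Finset.sum_congr rfl fun i _ => ?_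
  rw [C_mul, zero_add, add_comm (i : ℤ), mul_assoc]

theorem X_pow_sub_one_dvd_mul_windowPoly_sub {m : ℕ} (hm : 0 < m) {s : ℤ → F}
    (hper : ∀ n : ℤ, s (n + m) = s n) (g : F[X]) :
    X ^ m - 1 ∣ g * windowPoly m s 0 - windowPoly m (lrsApply g s) 0 := by
  rw [windowPoly_lrsApply]
  nth_rewrite 1 [g.as_sum_range_C_mul_X_pow]
  rw [Finset.sum_mul, ← Finset.sum_sub_distrib]
  refine Finset.dvd_sum fun k _ => ?_
  rw [mul_assoc, ← mul_sub]
  exact (X_pow_sub_one_dvd_X_pow_mul_windowPoly_sub hm hper k).mul_left _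

/-- A polynomial annihilates an `m`-periodic sequence iff its product with the generating
polynomial of one period vanishes modulo `x^m - 1`. -/
theorem lrsApply_eq_zero_iff_dvd [Nontrivial F] {m : ℕ} (hm : 0 < m) {s : ℤ → F}
    (hper : ∀ n : ℤ, s (n + m) = s n) (g : F[X]) :
    lrsApply g s = 0 ↔ X ^ m - 1 ∣ g * windowPoly m s 0 := by
  rw [← windowPoly_eq_zero_iff hm (lrsApply_add_period hper g),
    dvd_iff_dvd_of_dvd_sub (X_pow_sub_one_dvd_mul_windowPoly_sub hm hper g)]
  refine ⟨fun h => h ▸ dvd_zero _, fun h => ?_⟩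
  have hmon : (X ^ m - 1 : F[X]).Monic := by simpa using monic_X_pow_sub_C (1 : F) hm.ne'
  by_contra hne
  refine hmon.not_dvd_of_degree_lt hne ?_ h
  have hdeg := degree_X_pow_sub_C hm (1 : F)
  rw [C_1] at hdeg
  rw [hdeg]
  exact degree_windowPoly_lt _ _ _

end Periodic

theorem Subgroup.sum_image_units_eq_zero {R : Type*} [CommRing R] [IsDomain R] {M : Subgroup Rˣ}
    (hM : M ≠ ⊥) {T : Finset R} (hT : (T : Set R) = ((↑) : Rˣ → R) '' M) : ∑ x ∈ T, x = 0 := by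
  obtain ⟨a, ha, ha1⟩ := M.bot_or_exists_ne_one.resolve_left hM
  have hmem : ∀ x, x ∈ T ↔ ∃ u ∈ M, (u : R) = x := fun x => by
    rw [← Finset.mem_coe, hT]
    rfl
  have key : ∑ x ∈ T, ((a : Rˣ) : R) * x = ∑ x ∈ T, x := by
    refine Finset.sum_bij' (fun x _ => ((a : Rˣ) : R) * x)
      (fun x _ => ((a⁻¹ : Rˣ) : R) * x) ?_ ?_ ?_ ?_ ?_
    · intro x hx
      obtain ⟨u, hu, rfl⟩ := (hmem x).1 hx
      exact (hmem _).2 ⟨a * u, M.mul_mem ha hu, by simp⟩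
    · intro x hx
      obtain ⟨u, hu, rfl⟩ := (hmem x).1 hx
      exact (hmem _).2 ⟨(a : Rˣ)⁻¹ * u, M.mul_mem (M.inv_mem ha) hu, by simp⟩
    · intro x _; simp
    · intro x _; simp
    · intro x _; rfl
  rw [← Finset.mul_sum] at key
  by_contra h
  exact ha1 (Units.ext (mul_right_cancel₀ h (key.trans (one_mul _).symm)))

theorem isCoprime_of_eq_gcd_mul {F : Type*} [Field F] {p q d f t : F[X]} (hd : d ≠ 0)
    (hp : p = d * f) (hq : q = d * t) (h : ∀ e, e ∣ p → e ∣ q → e ∣ d) : IsCoprime f t := by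
  classical
  obtain ⟨c, hc⟩ := h _ (EuclideanDomain.gcd_dvd_left p q) (EuclideanDomain.gcd_dvd_right p q)
  refine ⟨c * EuclideanDomain.gcdA p q, c * EuclideanDomain.gcdB p q, mul_left_cancel₀ hd ?_⟩
  have hb := EuclideanDomain.gcd_eq_gcd_ab p q
  linear_combination (-c * hb - hc - c * EuclideanDomain.gcdA p q * hp
    - c * EuclideanDomain.gcdB p q * hq)

theorem isCoprime_X_sub_one_cyclotomic {F : Type*} [Field F] {m : ℕ} (hm : 1 < m)
    (h : (m : F) ≠ 0) : IsCoprime (X - 1) (cyclotomic m F) := by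
  have hdvd := X_pow_sub_one_mul_cyclotomic_dvd_X_pow_sub_one_of_dvd F
    (Nat.mem_properDivisors.2 ⟨one_dvd m, hm⟩)
  rw [pow_one] at hdvd
  exact ((X_pow_sub_one_separable_iff.2 h).of_dvd hdvd).isCoprime

/-- Let `E` be a field of characteristic `p`, `m > 1` with `gcd(m, p) = 1` if `p > 0`.
Suppose `s_0, …, s_{m-1}` enumerate a multiplicative subgroup `M` of `E^*` of order `m`
(given as the values on `0, …, m-1` of a period-`m` sequence `s`), and the `m`-th cyclotomic
polynomial `Φ_m` over `E` divides `s̃(x) = s_0 x^{m-1} + ⋯ + s_{m-1}`. Let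
`f = (x^m - 1)/gcd(x^m - 1, s̃)` (with `d` the monic gcd). Then `f` divides
`(x^m - 1)/((x - 1)·Φ_m)`, and `s` is an `f`-sequence presenting `M` with minimal
recursion `f`; hence `M` is an automatically non-standard `f`-subgroup. -/
theorem automatically_nonstandard_of_cyclotomic_dvd {E : Type*} [Field E]
    (m : ℕ) (hm : 1 < m)
    (hchar : ringChar E = 0 ∨ Nat.Coprime m (ringChar E))
    (M : Subgroup Eˣ) (hcard : Nat.card M = m)
    (s : ℤ → E) (hper : ∀ n : ℤ, s (n + m) = s n)
    (hinj : Function.Injective fun i : Fin m => s ((i : ℕ) : ℤ))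
    (hrange : (Set.range fun i : Fin m => s ((i : ℕ) : ℤ)) = ((↑) : Eˣ → E) '' M)
    (hcyc : cyclotomic m E ∣ ∑ i ∈ Finset.range m, C (s i) * X ^ (m - 1 - i))
    (d : Polynomial E) (hd : d.Monic)
    (hd1 : d ∣ X ^ m - 1) (hd2 : d ∣ ∑ i ∈ Finset.range m, C (s i) * X ^ (m - 1 - i))
    (hdgcd : ∀ e : Polynomial E,
      e ∣ X ^ m - 1 → e ∣ (∑ i ∈ Finset.range m, C (s i) * X ^ (m - 1 - i)) → e ∣ d)
    (f : Polynomial E) (hf : f = (X ^ m - 1) / d) :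
    f ∣ (X ^ m - 1) / ((X - 1) * cyclotomic m E) ∧
    lrsApply f s = 0 ∧
    f.Monic ∧
    (∀ g : Polynomial E, lrsApply g s = 0 ↔ f ∣ g) := by
  have hm0 : 0 < m := by omega
  have hwin : windowPoly m s 0 = ∑ i ∈ Finset.range m, C (s i) * X ^ (m - 1 - i) := by
    simp [windowPoly]
  have hmE : (m : E) ≠ 0 := by
    rw [Ne, ringChar.spec]
    rcases hchar with h | h
    · rw [h, zero_dvd_iff]
      exact hm0.ne'
    · intro hdvd
      exact CharP.ringChar_ne_one (Nat.Coprime.eq_one_of_dvd h.symm hdvd)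
  have hX1 : (X - 1 : E[X]) ∣ ∑ i ∈ Finset.range m, C (s i) * X ^ (m - 1 - i) := by
    classical
    rw [← C_1, dvd_iff_isRoot, IsRoot.def, eval_finsetSum]
    have hM : M ≠ ⊥ := by
      rintro rfl
      rw [Subgroup.card_bot] at hcard
      omega
    have h := Subgroup.sum_image_units_eq_zero hM
      (T := Finset.univ.image fun i : Fin m => s ((i : ℕ) : ℤ)) (by simpa using hrange)
    rw [Finset.sum_image hinj.injOn, Fin.sum_univ_eq_sum_range (fun i : ℕ => s (i : ℤ))] at h
    simpa using h
  have hmulX : (X - 1) * cyclotomic m E ∣ d :=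
    (isCoprime_X_sub_one_cyclotomic hm hmE).mul_dvd
      (hdgcd _ (by simpa using sub_dvd_pow_sub_pow (X : E[X]) 1 m) hX1)
      (hdgcd _ (cyclotomic.dvd_X_pow_sub_one m E) hcyc)
  obtain ⟨c, hc⟩ := hmulX
  obtain ⟨f', hf'⟩ := hd1
  obtain rfl : f = f' := by rw [hf, hf', mul_div_cancel_left₀ _ hd.ne_zero]
  have ⟨t, ht⟩ := hd2
  have hcop : IsCoprime f t := isCoprime_of_eq_gcd_mul hd.ne_zero hf' ht hdgcd
  have hmin : ∀ g : E[X], lrsApply g s = 0 ↔ f ∣ g := fun g => by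
    rw [lrsApply_eq_zero_iff_dvd hm0 hper, hwin, ht, hf', mul_left_comm,
      mul_dvd_mul_iff_left hd.ne_zero]
    exact ⟨hcop.dvd_of_dvd_mul_right, fun h => h.mul_right t⟩
  refine ⟨?_, (hmin f).2 dvd_rfl, ?_, hmin⟩
  · have hne : (X - 1) * cyclotomic m E ≠ 0 := by
      intro h
      exact hd.ne_zero (by rw [hc, h, zero_mul])
    rw [hf', hc, mul_assoc, mul_div_cancel_left₀ _ hne]
    exact dvd_mul_left _ _
  · refine hd.of_mul_monic_left ?_
    rw [← hf']
    simpa using monic_X_pow_sub_C (1 : E) hm0.ne'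
end
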